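/- Let (u_k)_{k∈ℕ} be a sequence of elements of a free group F(A). Then there exists an infinite subsequence (u_{k_n})_{n∈ℕ} and exponents d_n ∈ {+1, −1} such that, setting w_n = u_{k_n}^{d_n}, for each n the cancellation in the product w_n w_{n+1} does not exceed the conjugating part of w_n nor that of w_{n+1}. -/

import Mathlib

/-- The amount of cancellation in the reduced product `x * y`. -/
def cancel {A : Type*} [DecidableEq A] (x y : FreeGroup A) : ℕ :=
  (x.toWord.length + y.toWord.length - (x * y).toWord.length) / 2

/-- The cyclically reduced length of `w`: the minimal reduced word length in the
conjugacy class of `w`. -/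
noncomputable def cyclLen {A : Type*} [DecidableEq A] (w : FreeGroup A) : ℕ :=
  sInf (Set.range fun g : FreeGroup A => (g⁻¹ * w * g).toWord.length)

/-- The length of the conjugating part `v` in the reduced form `w = v w' v⁻¹` with `w'`
cyclically reduced. -/
noncomputable def cpLen {A : Type*} [DecidableEq A] (w : FreeGroup A) : ℕ :=
  (w.toWord.length - cyclLen w) / 2

namespace SmallCancel

open FreeGroup

variable {A : Type*} [DecidableEq A]

lemma split_common {B : Type*} [DecidableEq B] (L M : List B) :
    ∃ p s t, L = p ++ s ∧ M = p ++ t ∧ ∀ a ∈ s.head?, ∀ b ∈ t.head?, a ≠ b := by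
  induction L generalizing M with
  | nil => exact ⟨[], [], M, by simp⟩
  | cons a L ih =>
    cases M with
    | nil => exact ⟨[], a :: L, [], by simp⟩
    | cons b M =>
      by_cases h : a = b
      · obtain ⟨p, s, t, h1, h2, h3⟩ := ih M
        exact ⟨a :: p, s, t, by simp [h1], by simp [h, h2], h3⟩
      · exact ⟨[], a :: L, b :: M, by simp, by simp, by simpa using h⟩

lemma isReduced_join {s t : List (A × Bool)} (hs : IsReduced s) (ht : IsReduced t)
    (h : ∀ a ∈ s.head?, ∀ b ∈ t.head?, a ≠ b) : IsReduced (invRev s ++ t) := by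
  have hs' : IsReduced (invRev s) := by
    rw [isReduced_iff_reduce_eq, reduce_invRev, hs.reduce_eq]
  unfold FreeGroup.IsReduced at *
  rw [List.isChain_append]
  refine ⟨hs', ht, ?_⟩
  intro a ha b hb hab
  simp only [invRev, List.getLast?_reverse, List.head?_map, Option.mem_def,
    Option.map_eq_some_iff] at ha
  obtain ⟨c, hc, rfl⟩ := ha
  have := h c hc b hb
  rcases c with ⟨c1, c2⟩
  rcases b with ⟨b1, b2⟩
  cases c2 <;> cases b2 <;> simp_all

/-- The reduced words of `a`, `b` share a prefix of length `m`. -/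
def Sh (m : ℕ) (a b : FreeGroup A) : Prop :=
  ∃ p, p.length = m ∧ p <+: a.toWord ∧ p <+: b.toWord

lemma Sh.symm {m : ℕ} {a b : FreeGroup A} (h : Sh m a b) : Sh m b a := by
  obtain ⟨p, h1, h2, h3⟩ := h
  exact ⟨p, h1, h3, h2⟩

lemma Sh.trans {m : ℕ} {a b c : FreeGroup A} (h : Sh m a b) (h' : Sh m b c) : Sh m a c := by
  obtain ⟨p, h1, h2, h3⟩ := h
  obtain ⟨q, k1, k2, k3⟩ := h'
  have : p = q := (List.prefix_of_prefix_length_le h3 k2 (by omega)).eq_of_length (by omega)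
  subst this
  exact ⟨p, h1, h2, k3⟩

lemma le_cancel_iff (m : ℕ) (x y : FreeGroup A) : m ≤ cancel x y ↔ Sh m x⁻¹ y := by
  obtain ⟨p, s, t, h1, h2, h3⟩ := split_common (x⁻¹).toWord y.toWord
  have hs : IsReduced s := by
    have := isReduced_toWord (x := x⁻¹)
    rw [h1] at this
    exact this.infix ⟨p, [], by simp⟩
  have ht : IsReduced t := by
    have := isReduced_toWord (x := y)
    rw [h2] at this
    exact this.infix ⟨p, [], by simp⟩
  have hx : x⁻¹ = mk p * mk s := by rw [mul_mk, ← h1, mk_toWord]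
  have hy : y = mk p * mk t := by rw [mul_mk, ← h2, mk_toWord]
  have hxy : x * y = mk (invRev s ++ t) := by
    rw [← mul_mk, ← inv_mk, hy, ← inv_inv x, hx]
    group
  have hl : (x * y).toWord.length = s.length + t.length := by
    rw [hxy, toWord_mk, (isReduced_join hs ht h3).reduce_eq]
    simp
  have hxl : x.toWord.length = p.length + s.length := by
    have := congrArg List.length h1
    simpa [toWord_inv] using this
  have hyl : y.toWord.length = p.length + t.length := by
    have := congrArg List.length h2
    simpa using this
  have hc : cancel x y = p.length := by
    unfold cancel
    omega
  rw [hc]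
  constructor
  · intro hm
    refine ⟨p.take m, by simpa using hm, ?_, ?_⟩
    · rw [h1]; exact (List.take_prefix m p).trans (List.prefix_append _ _)
    · rw [h2]; exact (List.take_prefix m p).trans (List.prefix_append _ _)
  · rintro ⟨q, rfl, q1, q2⟩
    by_contra hlt
    push Not at hlt
    rw [h1] at q1
    rw [h2] at q2
    have hp : p <+: q := List.prefix_of_prefix_length_le (List.prefix_append _ _) q1 hlt.le
    obtain ⟨r, rfl⟩ := hp
    rw [List.prefix_append_right_inj] at q1 q2
    cases r with
    | nil => simp at hlt
    | cons c r =>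
      obtain ⟨r1, rfl⟩ := q1
      obtain ⟨r2, rfl⟩ := q2
      exact h3 c (by simp) c (by simp) rfl

lemma cancel_self_le (w : FreeGroup A) : cancel w w ≤ cpLen w := by
  have hw := reduceCyclically.conj_conjugator_reduceCyclically w.toWord
  have h2 := reduceCyclically.reduce_flatten_replicate_succ (isReduced_toWord (x := w)) 1
  set v := reduceCyclically.conjugator w.toWord
  set c := reduceCyclically w.toWord
  have hl : w.toWord.length = v.length + c.length + v.length := by
    rw [← hw]; simp [add_assoc]
  have hl2 : (w * w).toWord.length = v.length + 2 * c.length + v.length := by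
    have : (w * w).toWord = FreeGroup.reduce (List.replicate (1+1) w.toWord).flatten := by
      rw [toWord_mul]; simp [List.replicate_succ]
    rw [this, h2]
    simp [List.replicate_succ]
    omega
  have hcy : cyclLen w ≤ c.length := by
    have h : cyclLen w ≤ ((mk v)⁻¹ * w * mk v).toWord.length := Nat.sInf_le ⟨mk v, rfl⟩
    have e : (mk v)⁻¹ * w * mk v = mk c := by
      have : w = mk v * mk c * (mk v)⁻¹ := by
        rw [inv_mk, mul_mk, mul_mk, hw, mk_toWord]
      rw [this]; group
    rw [e] at h
    exact h.trans norm_mk_le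
  unfold cancel cpLen
  omega

lemma cancel_self_inv (w : FreeGroup A) : cancel w⁻¹ w⁻¹ = cancel w w := by
  have : ∀ m, m ≤ cancel w⁻¹ w⁻¹ ↔ m ≤ cancel w w := by
    intro m
    rw [le_cancel_iff, le_cancel_iff, inv_inv]
    exact ⟨Sh.symm, Sh.symm⟩
  exact le_antisymm ((this _).1 le_rfl) ((this _).2 le_rfl)

/-- `sg d w` is `w` or its inverse. -/
def sg (d : Bool) (w : FreeGroup A) : FreeGroup A := if d then w else w⁻¹

lemma cancel_self_sg (d : Bool) (w : FreeGroup A) :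
    cancel (sg d w) (sg d w) = cancel w w := by
  cases d <;> simp [sg, cancel_self_inv]

lemma step_down (x y : FreeGroup A) : ∃ d : Bool, cancel x (sg d y) ≤ cancel y y := by
  by_contra! h
  have h1 := h true
  have h2 := h false
  simp only [sg] at h1 h2
  rw [← Nat.succ_le_iff, le_cancel_iff] at h1 h2
  have : cancel y y + 1 ≤ cancel y y := (le_cancel_iff _ _ _).2 (h2.symm.trans h1)
  omega

lemma step_up (x y : FreeGroup A) (hxy : cancel x x < cancel y y) :
    ∃ d : Bool, ∀ e : Bool, cancel (sg d x) (sg e y) ≤ cancel x x := by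
  by_contra! h
  have hy : Sh (cancel x x + 1) y⁻¹ y := (le_cancel_iff _ _ _).1 hxy
  have key : ∀ d, Sh (cancel x x + 1) (sg d x)⁻¹ y := by
    intro d
    obtain ⟨e, he⟩ := h d
    have he' := (le_cancel_iff _ _ _).1 (Nat.succ_le_iff.2 he)
    cases e
    · exact he'.trans hy
    · exact he'
  have h1 := key true
  have h2 := key false
  simp only [sg] at h1 h2
  have : cancel x x + 1 ≤ cancel x x := (le_cancel_iff _ _ _).2 (h1.trans (by simpa using h2.symm))
  omega

lemma main (u : ℕ → FreeGroup A) :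
    ∃ k : ℕ → ℕ, StrictMono k ∧ ∃ d : ℕ → Bool, ∀ n : ℕ,
      cancel (sg (d n) (u (k n))) (sg (d (n+1)) (u (k (n+1)))) ≤
        min (cancel (u (k n)) (u (k n))) (cancel (u (k (n+1))) (u (k (n+1)))) := by
  obtain ⟨g, hg⟩ := exists_increasing_or_nonincreasing_subseq (· < ·)
    (fun n => cancel (u n) (u n))
  refine ⟨g, g.strictMono, ?_⟩
  rcases hg with hg | hg
  · have hlt : ∀ n, cancel (u (g n)) (u (g n)) < cancel (u (g (n+1))) (u (g (n+1))) :=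
      fun n => hg n (n+1) (Nat.lt_succ_self n)
    choose d hd using fun n => step_up _ _ (hlt n)
    exact ⟨d, fun n => le_min (hd n _) ((hd n _).trans (hlt n).le)⟩
  · have hle : ∀ n, cancel (u (g (n+1))) (u (g (n+1))) ≤ cancel (u (g n)) (u (g n)) :=
      fun n => not_lt.1 (hg n (n+1) (Nat.lt_succ_self n))
    choose f hf using fun (x y : FreeGroup A) => step_down x y
    let d : ℕ → Bool := fun n => Nat.rec true
      (fun n b => f (sg b (u (g n))) (u (g (n+1)))) n
    refine ⟨d, fun n => ?_⟩
    have := hf (sg (d n) (u (g n))) (u (g (n+1)))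
    exact le_min (this.trans (hle n)) this

end SmallCancel

/-- Given a sequence `(u_k)` in a free group, one can pass to a subsequence and choose
exponents `±1` so that in each consecutive product the cancellation does not exceed the
conjugating part of either factor. -/
theorem subsequence_small_cancellation {A : Type*} [DecidableEq A]
    (u : ℕ → FreeGroup A) :
    ∃ k : ℕ → ℕ, StrictMono k ∧ ∃ d : ℕ → Bool,
      ∀ n : ℕ,
        cancel (if d n then u (k n) else (u (k n))⁻¹)
               (if d (n+1) then u (k (n+1)) else (u (k (n+1)))⁻¹) ≤
          min (cpLen (if d n then u (k n) else (u (k n))⁻¹))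
              (cpLen (if d (n+1) then u (k (n+1)) else (u (k (n+1)))⁻¹)) := by
  obtain ⟨k, hk, d, hd⟩ := SmallCancel.main u
  refine ⟨k, hk, d, fun n => (hd n).trans (min_le_min ?_ ?_)⟩
  · rw [← SmallCancel.cancel_self_sg (d n)]
    exact SmallCancel.cancel_self_le _
  · rw [← SmallCancel.cancel_self_sg (d (n+1))]
    exact SmallCancel.cancel_self_le _
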